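/- arXiv:1805.11397 — 2 statements merged into one kernel-verified Lean document; each statement's English description precedes it below -/
import Mathlib

section
/- For n = 4, with basis vectors g_1, g_2, g_3 of ℝ^3, the vector g_1 + g_3 satisfies ‖g_1 + g_3‖_♭ = 1 while ‖g_1 + g_3‖_♮ > 1. -/
/-- The flat norm `‖x‖_♭` on `ℝ^m`. -/
noncomputable def flatNorm {m : ℕ} (x : Fin m → ℝ) : ℝ :=
  (⨆ i, max (x i) 0) + ⨆ i, max (-x i) 0

/-- The set `𝒢` of consecutive sums `∑_{k=i}^{j} g_k` of standard basis
vectors of `ℝ^m`. -/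
def consecSums (m : ℕ) : Set (Fin m → ℝ) :=
  {θ | ∃ i j : Fin m, i ≤ j ∧ θ = fun l => if i ≤ l ∧ l ≤ j then (1 : ℝ) else 0}

/-- The natural norm `‖·`‖_♮`: the gauge of the convex hull of `𝒢 ∪ (-𝒢)`. -/
noncomputable def natNorm {m : ℕ} (x : Fin m → ℝ) : ℝ :=
  gauge (convexHull ℝ (consecSums m ∪ -consecSums m)) x

/-- In `ℝ^3` (the case `n = 4`), the vector `g_1 + g_3` has flat norm `1`
but natural norm strictly bigger than `1`. -/
theorem flatNorm_eq_one_natNorm_gt_one :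
    flatNorm (Pi.single 0 (1 : ℝ) + Pi.single 2 (1 : ℝ) : Fin 3 → ℝ) = 1 ∧
    1 < natNorm (Pi.single 0 (1 : ℝ) + Pi.single 2 (1 : ℝ) : Fin 3 → ℝ) := by
  constructor
  · have h1 : (⨆ i, max ((Pi.single 0 (1 : ℝ) + Pi.single 2 (1 : ℝ) : Fin 3 → ℝ) i) 0) = 1 := by
      apply le_antisymm
      · apply ciSup_le
        intro i
        fin_cases i <;> simp
      · refine le_trans ?_ (le_ciSup (Set.finite_range _).bddAbove (0 : Fin 3))
        simp
    have h2 : (⨆ i, max (-(Pi.single 0 (1 : ℝ) + Pi.single 2 (1 : ℝ) : Fin 3 → ℝ) i) 0) = 0 := by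
      apply le_antisymm
      · apply ciSup_le
        intro i
        fin_cases i <;> simp
      · refine le_trans ?_ (le_ciSup (Set.finite_range _).bddAbove (0 : Fin 3))
        simp
    unfold flatNorm
    rw [h1, h2, add_zero]
  · have hK : convexHull ℝ (consecSums 3 ∪ -consecSums 3) ⊆
        {y : Fin 3 → ℝ | y 0 - y 1 + y 2 ≤ 1} := by
      apply convexHull_min
      · rintro y (⟨i, j, hij, rfl⟩ | ⟨i, j, hij, hy⟩)
        · fin_cases i <;> fin_cases j <;> simp at hij ⊢
        · have hy' : y = -(fun l => if i ≤ l ∧ l ≤ j then (1 : ℝ) else 0) := by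
            rw [← hy, neg_neg]
          subst hy'
          fin_cases i <;> fin_cases j <;> simp at hij ⊢ <;> norm_num
      · intro a ha b hb s t hs ht hst
        simp only [Set.mem_ofPred_eq, Pi.add_apply, Pi.smul_apply, smul_eq_mul] at *
        nlinarith
    have h0 : (Pi.single 0 (1 : ℝ) : Fin 3 → ℝ) ∈ consecSums 3 :=
      ⟨0, 0, le_rfl, by ext l; fin_cases l <;> simp⟩
    have h2 : (Pi.single 2 (1 : ℝ) : Fin 3 → ℝ) ∈ consecSums 3 :=
      ⟨2, 2, le_rfl, by ext l; fin_cases l <;> simp⟩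
    have m0 := subset_convexHull ℝ (consecSums 3 ∪ -consecSums 3) (Set.mem_union_left _ h0)
    have m2 := subset_convexHull ℝ (consecSums 3 ∪ -consecSums 3) (Set.mem_union_left _ h2)
    refine lt_of_lt_of_le one_lt_two ?_
    unfold natNorm
    rw [gauge_def]
    apply le_csInf
    · refine ⟨2, by simp, (1 / 2 : ℝ) • Pi.single 0 (1 : ℝ) + (1 / 2 : ℝ) • Pi.single 2 (1 : ℝ),
        ?_, ?_⟩
      · exact convex_convexHull ℝ _ m0
          m2 (by norm_num) (by norm_num) (by norm_num)
      · ext l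
        fin_cases l <;> simp
    · rintro r ⟨hr, y, hy, hxy⟩
      have hy1 := hK hy
      have e0 := congrFun hxy 0
      have e1 := congrFun hxy 1
      have e2 := congrFun hxy 2
      simp at e0 e1 e2 hy1 hr
      rcases e1 with e1 | e1
      · linarith
      · nlinarith
end

section
/- For n = 3, the norms ‖·‖_♭ and ‖·‖_♮ on ℝ^2 coincide: for every x ∈ ℝ^2 (coefficients over the basis g_1, g_2), ‖x‖_♭ = ‖x‖_♮, where ‖·‖_♮ is the gauge of the convex hull of ±{g_1, g_2, g_1+g_2}. -/
/-- The consecutive sums of the basis of `ℝ²`: `{g₁, g₂, g₁ + g₂}`. -/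
def consec2 : Set (Fin 2 → ℝ) :=
  {Pi.single 0 (1 : ℝ), Pi.single 1 (1 : ℝ), fun _ => (1 : ℝ)}

lemma flatNorm_two (x : Fin 2 → ℝ) :
    flatNorm x = max (max (x 0) 0) (max (x 1) 0) + max (max (-x 0) 0) (max (-x 1) 0) := by
  have key : ∀ f : Fin 2 → ℝ, (⨆ i, f i) = max (f 0) (f 1) := by
    intro f
    apply le_antisymm
    · apply ciSup_le
      intro i
      fin_cases i <;> simp
    · exact max_le (le_ciSup (Set.finite_range f).bddAbove 0)
        (le_ciSup (Set.finite_range f).bddAbove 1)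
  unfold flatNorm
  rw [key, key]

lemma hull_bound (y : Fin 2 → ℝ) (hy : y ∈ convexHull ℝ (consec2 ∪ -consec2)) :
    (|y 0| ≤ 1 ∧ |y 1| ≤ 1) ∧ |y 0 - y 1| ≤ 1 := by
  have hc : Convex ℝ {y : Fin 2 → ℝ | (|y 0| ≤ 1 ∧ |y 1| ≤ 1) ∧ |y 0 - y 1| ≤ 1} := by
    intro u hu v hv a b ha hb hab
    simp only [Set.mem_ofPred_eq, abs_le, Pi.add_apply, Pi.smul_apply, smul_eq_mul] at *
    obtain ⟨⟨⟨h1, h2⟩, h3, h4⟩, h5, h6⟩ := hu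
    obtain ⟨⟨⟨k1, k2⟩, k3, k4⟩, k5, k6⟩ := hv
    refine ⟨⟨⟨?_, ?_⟩, ?_, ?_⟩, ?_, ?_⟩ <;> nlinarith
  refine convexHull_min ?_ hc hy
  rintro z (hz | hz)
  · rcases hz with rfl | rfl | rfl <;> simp
  · rw [Set.mem_neg] at hz
    have e0 : z 0 = -((-z) 0) := by simp
    have e1 : z 1 = -((-z) 1) := by simp
    simp only [Set.mem_ofPred_eq]
    rw [e0, e1]
    rcases hz with h | h | h <;> rw [h] <;> simp

open scoped Pointwise in
lemma comb_mem (x p q : Fin 2 → ℝ) (a b r : ℝ) (ha : 0 ≤ a) (hb : 0 ≤ b)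
    (hp : p ∈ consec2 ∪ -consec2) (hq : q ∈ consec2 ∪ -consec2) (hr : r = a + b)
    (h0 : x 0 = a * p 0 + b * q 0) (h1 : x 1 = a * p 1 + b * q 1) :
    x ∈ r • convexHull ℝ (consec2 ∪ -consec2) := by
  rw [hr, (convex_convexHull ℝ _).add_smul ha hb]
  have : x = a • p + b • q := by
    ext i
    fin_cases i <;> simp [h0, h1]
  rw [this]
  exact Set.add_mem_add (Set.smul_mem_smul_set (subset_convexHull ℝ _ hp))
    (Set.smul_mem_smul_set (subset_convexHull ℝ _ hq))

open scoped Pointwise in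
lemma mem_flat_smul (x : Fin 2 → ℝ) :
    x ∈ flatNorm x • convexHull ℝ (consec2 ∪ -consec2) := by
  have p1 : (Pi.single 0 1 : Fin 2 → ℝ) ∈ consec2 ∪ -consec2 := by simp [consec2]
  have p2 : (Pi.single 1 1 : Fin 2 → ℝ) ∈ consec2 ∪ -consec2 := by simp [consec2]
  have p3 : (fun _ => 1 : Fin 2 → ℝ) ∈ consec2 ∪ -consec2 := by simp [consec2]
  have hn : ∀ p : Fin 2 → ℝ, p ∈ consec2 ∪ -consec2 → -p ∈ consec2 ∪ -consec2 := by
    intro p hp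
    rcases hp with hp | hp
    · right; simpa using hp
    · left; exact hp
  rw [flatNorm_two]
  rcases le_total 0 (x 0) with h0 | h0 <;> rcases le_total 0 (x 1) with h1 | h1
  · rcases le_total (x 0) (x 1) with h | h
    · refine comb_mem x _ _ (x 0) (x 1 - x 0) _ h0 (by linarith) p3 p2 ?_ ?_ ?_
      · simp [h0, h1, h]
      · simp
      · simp
    · refine comb_mem x _ _ (x 1) (x 0 - x 1) _ h1 (by linarith) p3 p1 ?_ ?_ ?_
      · simp [h0, h1, h]
      · simp
      · simp
  · refine comb_mem x _ _ (x 0) (-x 1) _ h0 (by linarith) p1 (hn _ p2) ?_ ?_ ?_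
    · simp [h0, h1]
    · simp
    · simp
  · refine comb_mem x _ _ (x 1) (-x 0) _ h1 (by linarith) p2 (hn _ p1) ?_ ?_ ?_
    · simp [h0, h1]
    · simp
    · simp
  · rcases le_total (x 0) (x 1) with h | h
    · refine comb_mem x _ _ (-x 1) (x 1 - x 0) _ (by linarith) (by linarith)
        (hn _ p3) (hn _ p1) ?_ ?_ ?_
      · simp [h0, h1, h]; ring
      · simp
      · simp
    · refine comb_mem x _ _ (-x 0) (x 0 - x 1) _ (by linarith) (by linarith)
        (hn _ p3) (hn _ p2) ?_ ?_ ?_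
      · simp [h0, h1, h]; ring
      · simp
      · simp

/-- For `n = 3` the norms `‖·‖_♭` and `‖·‖_♮` on `ℝ²` coincide: the flat norm
equals the gauge of the convex hull of `±{g₁, g₂, g₁ + g₂}`. -/
theorem flatNorm_eq_natNorm_dim_two (x : Fin 2 → ℝ) :
    flatNorm x = gauge (convexHull ℝ (consec2 ∪ -consec2)) x := by
  have hnn : 0 ≤ flatNorm x := by
    rw [flatNorm_two]; positivity
  apply le_antisymm
  · rcases hnn.eq_or_lt with h | h
    · rw [← h]; exact gauge_nonneg _
    · refine le_csInf ⟨flatNorm x, h, mem_flat_smul x⟩ ?_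
      rintro r ⟨hr, y, hy, rfl⟩
      replace hr : 0 < r := hr
      obtain ⟨⟨h1, h2⟩, h3⟩ := hull_bound y hy
      rw [abs_le] at h1 h2 h3
      rw [flatNorm_two]
      simp only [Pi.smul_apply, smul_eq_mul]
      have a1 : r * y 0 ≤ r := by nlinarith
      have a2 : -(r * y 0) ≤ r := by nlinarith
      have a3 : r * y 1 ≤ r := by nlinarith
      have a4 : -(r * y 1) ≤ r := by nlinarith
      have a5 : r * y 0 - r * y 1 ≤ r := by nlinarith
      have a6 : r * y 1 - r * y 0 ≤ r := by nlinarith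
      generalize r * y 0 = a at *
      generalize r * y 1 = b at *
      rw [← le_sub_iff_add_le]
      refine max_le (max_le ?_ ?_) (max_le ?_ ?_) <;> rw [le_sub_comm] <;>
        refine max_le (max_le ?_ ?_) (max_le ?_ ?_) <;> linarith
  · exact gauge_le_of_mem hnn (mem_flat_smul x)
end
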